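/- Let n ∈ ℕ, ħ > 0, masses m : Fin n → ℝ with m j > 0 for all j, and V : ℝⁿ → ℝ. Suppose ψ : ℝ × ℝⁿ → ℂ is twice continuously differentiable, nowhere vanishing, satisfies the Schrödinger equation iħ ∂ψ/∂t = −Σ_j (ħ²/(2·m j)) ∂_j²ψ + Vψ at every point, and that |ψ(0,·)|² is integrable. Suppose φ : ℝ × ℝⁿ → ℝⁿ is a flow of the Bohmian velocity field, i.e., φ(0,x) = x, ∂φ/∂t(t,x) = v^{ψ(t,·)}(φ(t,x)) for all (t,x), φ is continuously differentiable jointly in (t,x), and each φ(t,·) is a C¹ diffeomorphism of ℝⁿ. Then the quantum equilibrium distribution is equivariant: for every t, Measure.map (φ(t,·)) (volume.withDensity |ψ(0,·)|²) = volume.withDensity |ψ(t,·)|². In particular, if the configuration is distributed with density |ψ(0,·)|² at time 0, then it is distributed with density |ψ(t,·)|² at every time t. -/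

import Mathlib

open Complex MeasureTheory

/-- Partial derivative of `f : ℝⁿ → ℂ` in the `j`-th coordinate direction. -/
noncomputable def partialDeriv (n : ℕ) (f : (Fin n → ℝ) → ℂ) (j : Fin n)
    (q : Fin n → ℝ) : ℂ :=
  fderiv ℝ f q (Pi.single j 1)



lemma aux_mixed {E : Type*} [NormedAddCommGroup E] [NormedSpace ℝ E] [FiniteDimensional ℝ E]
    (φ w : ℝ × E → E) (hφ : ContDiff ℝ 1 φ) (hw : ContDiff ℝ 1 w)
    (h : ∀ t x, HasDerivAt (fun s => φ (s, x)) (w (t, x)) t) (t : ℝ) (x : E) :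
    HasDerivAt (fun s => (fderiv ℝ φ (s, x)).comp (ContinuousLinearMap.inr ℝ ℝ E))
      ((fderiv ℝ w (t, x)).comp (ContinuousLinearMap.inr ℝ ℝ E)) t := by
  have part : ∀ f : ℝ × E → E, ContDiff ℝ 1 f → ∀ s y, HasFDerivAt (fun y => f (s, y))
      ((fderiv ℝ f (s, y)).comp (ContinuousLinearMap.inr ℝ ℝ E)) y := by
    intro f hf s y
    have h1 : HasFDerivAt f (fderiv ℝ f (s, y)) (s, y) :=
      ((hf.differentiable one_ne_zero) (s, y)).hasFDerivAt
    exact h1.comp y (hasFDerivAt_prodMk_right s y)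
  have hwc : Continuous w := hw.continuous
  have hGc : Continuous (fun p : ℝ × E => (fderiv ℝ w p).comp (ContinuousLinearMap.inr ℝ ℝ E)) :=
    (hw.continuous_fderiv one_ne_zero).clm_comp continuous_const
  have key : ∀ s, (fderiv ℝ φ (s, x)).comp (ContinuousLinearMap.inr ℝ ℝ E) =
      (fderiv ℝ φ (0, x)).comp (ContinuousLinearMap.inr ℝ ℝ E) +
      ∫ r in (0:ℝ)..s, (fderiv ℝ w (r, x)).comp (ContinuousLinearMap.inr ℝ ℝ E) := by
    intro s
    have e : (fun y => φ (s, y)) = fun y => φ (0, y) + ∫ r in (0:ℝ)..s, w (r, y) := by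
      funext y
      rw [intervalIntegral.integral_eq_sub_of_hasDerivAt (fun r _ => h r y)]
      · abel
      · exact (hwc.comp (by fun_prop : Continuous fun r : ℝ => (r, y))).intervalIntegrable _ _
    have hK : IsCompact (Set.uIcc (0:ℝ) s ×ˢ Metric.closedBall x 1) :=
      isCompact_uIcc.prod (isCompact_closedBall x 1)
    obtain ⟨C, hC⟩ := hK.exists_bound_of_continuousOn hGc.continuousOn
    have hI := intervalIntegral.hasFDerivAt_integral_of_dominated_of_fderiv_le (𝕜 := ℝ)
      (μ := volume) (a := 0) (b := s) (x₀ := x) (s := Metric.closedBall x 1)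
      (bound := fun _ => C) (F := fun y r => w (r, y))
      (F' := fun y r => (fderiv ℝ w (r, y)).comp (ContinuousLinearMap.inr ℝ ℝ E))
      (Metric.closedBall_mem_nhds x one_pos)
      (Filter.Eventually.of_forall fun y =>
        (hwc.comp (by fun_prop : Continuous fun r : ℝ => (r, y))).aestronglyMeasurable)
      ((hwc.comp (by fun_prop : Continuous fun r : ℝ => (r, x))).intervalIntegrable _ _)
      ((hGc.comp (by fun_prop : Continuous fun r : ℝ => (r, x))).aestronglyMeasurable)
      (Filter.Eventually.of_forall fun r hr y hy => hC (r, y) ⟨Set.uIoc_subset_uIcc hr, hy⟩)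
      (by simp)
      (Filter.Eventually.of_forall fun r hr y hy => part w hw r y)
    have h2 := (part φ hφ 0 x).add hI
    have h3 := part φ hφ s x
    rw [e] at h3
    exact h3.unique h2
  rw [funext key]
  refine HasDerivAt.const_add _ ?_
  have hc : Continuous fun r : ℝ => (fderiv ℝ w (r, x)).comp (ContinuousLinearMap.inr ℝ ℝ E) :=
    hGc.comp (by fun_prop : Continuous fun r : ℝ => (r, x))
  exact intervalIntegral.integral_hasDerivAt_right (hc.intervalIntegrable _ _)
    hc.aestronglyMeasurable.stronglyMeasurableAtFilter hc.continuousAt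

lemma aux_det {n : ℕ} (J : ℝ → Matrix (Fin n) (Fin n) ℝ) (A : Matrix (Fin n) (Fin n) ℝ) (t : ℝ)
    (h : ∀ i j, HasDerivAt (fun s => J s i j) ((A * J t) i j) t) :
    HasDerivAt (fun s => (J s).det) (A.trace * (J t).det) t := by
  let D : ContinuousMultilinearMap ℝ (fun _ : Fin n => Fin n → ℝ) ℝ :=
    { (Matrix.detRowAlternating (n := Fin n) (R := ℝ)).toMultilinearMap with
      cont := by
        change Continuous fun M : Matrix (Fin n) (Fin n) ℝ => M.det
        exact Continuous.matrix_det continuous_id }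
  have hD : ∀ M : Matrix (Fin n) (Fin n) ℝ, D M = M.det := fun M => rfl
  have hJ : HasDerivAt (fun s => (fun i => J s i : Fin n → Fin n → ℝ)) (fun i => (A * J t) i) t := by
    rw [hasDerivAt_pi]; intro i
    rw [hasDerivAt_pi]; intro j
    exact h i j
  have := (D.hasFDerivAt (x := fun i => J t i)).comp_hasDerivAt t hJ
  refine this.congr_deriv ?_
  rw [ContinuousMultilinearMap.linearDeriv_apply, Matrix.trace, Finset.sum_mul]
  refine Finset.sum_congr rfl fun i _ => ?_
  have e := Matrix.det_updateRow_sum (J t) i (fun k => A i k)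
  rw [smul_eq_mul] at e
  rw [Matrix.diag_apply, ← e]
  change Matrix.det (Function.update _ _ _) = _
  congr 1
  unfold Matrix.updateRow
  congr 1
  funext j
  simp [Matrix.mul_apply, Finset.sum_apply]

lemma aux_slice {n : ℕ} (f : ℝ × (Fin n → ℝ) → ℂ) (hf : Differentiable ℝ f) (t : ℝ)
    (j : Fin n) (q : Fin n → ℝ) :
    partialDeriv n (fun q => f (t, q)) j q = fderiv ℝ f (t, q) (0, Pi.single j 1) := by
  have h1 : HasFDerivAt (fun q => f (t, q))
      ((fderiv ℝ f (t, q)).comp (ContinuousLinearMap.inr ℝ ℝ _)) q :=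
    (hf (t, q)).hasFDerivAt.comp q (hasFDerivAt_prodMk_right t q)
  unfold partialDeriv
  rw [h1.fderiv]; simp

/-- Algebraic form of the continuity equation. -/
lemma aux_alg {n : ℕ} (hbar : ℝ) (hhb : 0 < hbar) (m : Fin n → ℝ) (hm : ∀ j, 0 < m j)
    (V : ℝ) (z zt : ℂ) (hz : z ≠ 0) (P PP : Fin n → ℂ)
    (hS : Complex.I * (hbar : ℂ) * zt =
      -∑ j, ((hbar ^ 2 / (2 * m j) : ℝ) : ℂ) * PP j + (V : ℂ) * z) :
    2 * (starRingEnd ℂ z * (zt + ∑ j, ((hbar / m j * (P j / z).im : ℝ) : ℂ) * P j)).re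
      + normSq z * ∑ j, hbar / m j * ((PP j * z - P j * P j) / z ^ 2).im = 0 := by
  have hzt : zt / z = -Complex.I * (-∑ j, ((hbar / (2 * m j) : ℝ) : ℂ) * (PP j / z)
      + ((V / hbar : ℝ) : ℂ)) := by
    have hb : (hbar : ℂ) ≠ 0 := by exact_mod_cast hhb.ne'
    have e : (hbar : ℂ) * z * (-∑ j, ((hbar / (2 * m j) : ℝ) : ℂ) * (PP j / z)
      + ((V / hbar : ℝ) : ℂ)) = Complex.I * (hbar : ℂ) * zt := by
      rw [hS, mul_add, mul_neg, Finset.mul_sum]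
      congr 1
      · congr 1
        refine Finset.sum_congr rfl fun j _ => ?_
        have : (m j : ℂ) ≠ 0 := by exact_mod_cast (hm j).ne'
        push_cast; field_simp
      · push_cast; field_simp
    rw [div_eq_iff hz]
    apply mul_left_cancel₀ hb
    calc (hbar : ℂ) * zt = -Complex.I * (Complex.I * hbar * zt) := by
          linear_combination (hbar * zt) * Complex.I_mul_I
      _ = _ := by rw [← e]; ring
  have hre : (zt / z).re = -∑ j, hbar / (2 * m j) * (PP j / z).im := by
    rw [hzt]
    simp [Complex.mul_re, Complex.mul_im, -Complex.ofReal_div, -Complex.ofReal_mul]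
  have hN : ∀ w : ℂ, (starRingEnd ℂ z * w).re = normSq z * (w / z).re := by
    intro w
    have : starRingEnd ℂ z * w = (normSq z : ℂ) * (w / z) := by
      rw [← Complex.mul_conj]; field_simp
    rw [this, Complex.re_ofReal_mul]
  rw [hN, add_div, Complex.add_re, hre, Finset.sum_div, Complex.re_sum]
  have h2 : ∀ j, ((PP j * z - P j * P j) / z ^ 2).im
      = (PP j / z).im - 2 * (P j / z).re * (P j / z).im := by
    intro j
    have : (PP j * z - P j * P j) / z ^ 2 = PP j / z - (P j / z) * (P j / z) := by
      field_simp
    rw [this, Complex.sub_im, Complex.mul_im]; ring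
  have h3 : ∀ j, (((hbar / m j * (P j / z).im : ℝ) : ℂ) * P j / z).re
      = hbar / m j * (P j / z).im * (P j / z).re := by
    intro j
    rw [mul_div_assoc, Complex.re_ofReal_mul]
  simp only [h2, h3]
  have : 2 * (normSq z * (-∑ j, hbar / (2 * m j) * (PP j / z).im
        + ∑ j, hbar / m j * (P j / z).im * (P j / z).re))
      + normSq z * ∑ j, hbar / m j * ((PP j / z).im - 2 * (P j / z).re * (P j / z).im)
      = normSq z * ∑ j, (2 * (-(hbar / (2 * m j) * (PP j / z).im)
        + hbar / m j * (P j / z).im * (P j / z).re)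
        + hbar / m j * ((PP j / z).im - 2 * (P j / z).re * (P j / z).im)) := by
    rw [Finset.sum_add_distrib, ← Finset.mul_sum, Finset.sum_add_distrib, Finset.sum_neg_distrib]
    ring
  rw [this]
  rw [Finset.sum_eq_zero, mul_zero]
  intro j _
  have := (hm j).ne'
  field_simp
  ring

/-- Equivariance of the quantum equilibrium distribution: if `ψ` is a nowhere vanishing,
twice continuously differentiable solution of the Schrödinger equation with `|ψ(0,·)|²`
integrable, and `φ` is a flow of the Bohmian velocity field
`v^ψ_j = (ħ/m_j) Im(∂_jψ/ψ)` (each time-`t` map a `C¹` diffeomorphism of `ℝⁿ`), then for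
every `t`, the pushforward of the measure with density `|ψ(0,·)|²` under `φ(t,·)` is the
measure with density `|ψ(t,·)|²`. -/
theorem quantum_equilibrium_equivariant (n : ℕ) (hbar : ℝ) (hhb : 0 < hbar)
    (m : Fin n → ℝ) (hm : ∀ j, 0 < m j) (V : (Fin n → ℝ) → ℝ)
    (ψ : ℝ × (Fin n → ℝ) → ℂ) (hψ : ContDiff ℝ 2 ψ)
    (hψ_ne : ∀ t q, ψ (t, q) ≠ 0)
    (hSch : ∀ t q, Complex.I * (hbar : ℂ) * fderiv ℝ ψ (t, q) (1, 0) =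
      -∑ j, ((hbar ^ 2 / (2 * m j) : ℝ) : ℂ) *
          partialDeriv n (fun q' => partialDeriv n (fun q'' => ψ (t, q'')) j q') j q
        + (V q : ℂ) * ψ (t, q))
    (hint : Integrable (fun q => Complex.normSq (ψ (0, q))) volume)
    (φ : ℝ × (Fin n → ℝ) → (Fin n → ℝ)) (hφ : ContDiff ℝ 1 φ)
    (hφ0 : ∀ x, φ (0, x) = x)
    (hφ' : ∀ t x, HasDerivAt (fun s => φ (s, x))
      (fun j => (hbar / m j) *
        (partialDeriv n (fun q => ψ (t, q)) j (φ (t, x)) / ψ (t, φ (t, x))).im) t)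
    (hφdiffeo : ∀ t, ∃ ι : (Fin n → ℝ) → (Fin n → ℝ), ContDiff ℝ 1 ι ∧
      Function.LeftInverse ι (fun x => φ (t, x)) ∧
      Function.RightInverse ι (fun x => φ (t, x))) :
    ∀ t, Measure.map (fun x => φ (t, x))
        (volume.withDensity (fun q => ENNReal.ofReal (Complex.normSq (ψ (0, q)))))
      = volume.withDensity (fun q => ENNReal.ofReal (Complex.normSq (ψ (t, q)))) := by
  have hψd : Differentiable ℝ ψ := hψ.differentiable two_ne_zero
  have hψ1 : ContDiff ℝ 1 ψ := hψ.of_le (by norm_num)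
  have hne : ∀ p, ψ p ≠ 0 := fun p => hψ_ne p.1 p.2
  let P : Fin n → ℝ × (Fin n → ℝ) → ℂ := fun j p => fderiv ℝ ψ p (0, Pi.single j 1)
  have hP : ∀ j, ContDiff ℝ 1 (P j) := fun j =>
    (hψ.fderiv_right (m := 1) (by norm_num)).clm_apply contDiff_const
  have hPd : ∀ j, Differentiable ℝ (P j) := fun j => (hP j).differentiable one_ne_zero
  have hpd : ∀ t j q, partialDeriv n (fun q => ψ (t, q)) j q = P j (t, q) :=
    fun t j q => aux_slice ψ hψd t j q
  let PP : Fin n → ℝ × (Fin n → ℝ) → ℂ := fun j p => fderiv ℝ (P j) p (0, Pi.single j 1)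
  have hppd : ∀ t j q, partialDeriv n (fun q => P j (t, q)) j q = PP j (t, q) :=
    fun t j q => aux_slice (P j) (hPd j) t j q
  simp only [hpd, hppd] at hSch hφ'
  let v : ℝ × (Fin n → ℝ) → (Fin n → ℝ) := fun p j => (hbar / m j) * (P j p / ψ p).im
  have hquot : ∀ j, ContDiff ℝ 1 (fun p => P j p / ψ p) := fun j => by
    simp only [div_eq_mul_inv]
    exact (hP j).mul (hψ1.inv hne)
  have hvj : ∀ j, ContDiff ℝ 1 (fun p => v p j) := fun j =>
    contDiff_const.mul (Complex.imCLM.contDiff.comp (hquot j))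
  have hv : ContDiff ℝ 1 v := contDiff_pi.2 hvj
  have hvd : Differentiable ℝ v := hv.differentiable one_ne_zero
  have hdiv : ∀ p j, fderiv ℝ v p (0, Pi.single j 1) j
      = hbar / m j * ((PP j p * ψ p - P j p * P j p) / ψ p ^ 2).im := by
    intro p j
    have hl : HasDerivAt (fun s : ℝ => p + s • ((0, Pi.single j 1) : ℝ × (Fin n → ℝ)))
        (0, Pi.single j 1) 0 := by
      simpa using ((hasDerivAt_id (0:ℝ)).smul_const
        ((0, Pi.single j 1) : ℝ × (Fin n → ℝ))).const_add p
    have hp0 : p + (0:ℝ) • ((0, Pi.single j 1) : ℝ × (Fin n → ℝ)) = p := by simp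
    have h1 : HasDerivAt (fun s : ℝ => v (p + s • ((0, Pi.single j 1) : ℝ × (Fin n → ℝ))))
        (fderiv ℝ v p (0, Pi.single j 1)) 0 :=
      HasFDerivAt.comp_hasDerivAt (l := v) (l' := fderiv ℝ v p) 0 (by rw [hp0]; exact (hvd p).hasFDerivAt) hl
    have h2 : HasDerivAt (fun s : ℝ => P j (p + s • ((0, Pi.single j 1) : ℝ × (Fin n → ℝ))))
        (PP j p) 0 :=
      HasFDerivAt.comp_hasDerivAt (l := P j) (l' := fderiv ℝ (P j) p) 0 (by rw [hp0]; exact (hPd j p).hasFDerivAt) hl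
    have h3 : HasDerivAt (fun s : ℝ => ψ (p + s • ((0, Pi.single j 1) : ℝ × (Fin n → ℝ))))
        (P j p) 0 :=
      HasFDerivAt.comp_hasDerivAt 0 (by rw [hp0]; exact (hψd p).hasFDerivAt) hl
    have h4 := h2.div h3 (hne _)
    rw [hp0] at h4
    have h5 := (Complex.imCLM.hasFDerivAt.comp_hasDerivAt 0 h4).const_mul (hbar / m j)
    exact ((hasDerivAt_pi.1 h1) j).unique h5
  let w : ℝ × (Fin n → ℝ) → (Fin n → ℝ) := fun p => v (p.1, φ p)
  have hw : ContDiff ℝ 1 w := hv.comp (contDiff_fst.prodMk hφ)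
  have hφd : Differentiable ℝ φ := hφ.differentiable one_ne_zero
  have hφw : ∀ t x, HasDerivAt (fun s => φ (s, x)) (w (t, x)) t := hφ'
  let J : ℝ → (Fin n → ℝ) → ((Fin n → ℝ) →L[ℝ] (Fin n → ℝ)) := fun t x =>
    (fderiv ℝ φ (t, x)).comp (ContinuousLinearMap.inr ℝ ℝ _)
  have hJφ : ∀ t x, HasFDerivAt (fun x => φ (t, x)) (J t x) x := fun t x =>
    (hφd (t, x)).hasFDerivAt.comp x (hasFDerivAt_prodMk_right t x)
  let A : ℝ → (Fin n → ℝ) → ((Fin n → ℝ) →L[ℝ] (Fin n → ℝ)) := fun t x =>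
    (fderiv ℝ v (t, φ (t, x))).comp (ContinuousLinearMap.inr ℝ ℝ _)
  have hJ' : ∀ t x, HasDerivAt (fun s => J s x) ((A t x).comp (J t x)) t := by
    intro t x
    refine (aux_mixed φ w hφ hw hφw t x).congr_deriv ?_
    have h1 : HasFDerivAt (fun y => w (t, y))
        ((fderiv ℝ w (t, x)).comp (ContinuousLinearMap.inr ℝ ℝ _)) x :=
      ((hw.differentiable one_ne_zero) (t, x)).hasFDerivAt.comp x (hasFDerivAt_prodMk_right t x)
    have h2 : HasFDerivAt (fun q => v (t, q)) (A t x) (φ (t, x)) :=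
      (hvd (t, φ (t, x))).hasFDerivAt.comp _ (hasFDerivAt_prodMk_right t _)
    have h3 := HasFDerivAt.comp (g := fun q => v (t, q)) x h2 (hJφ t x)
    exact h1.unique h3
  have hdet' : ∀ t x, HasDerivAt (fun s => (J s x).det)
      ((∑ j, hbar / m j * ((PP j (t, φ (t, x)) * ψ (t, φ (t, x))
        - P j (t, φ (t, x)) * P j (t, φ (t, x))) / ψ (t, φ (t, x)) ^ 2).im) * (J t x).det) t := by
    intro t x
    have h1 := aux_det (fun s => LinearMap.toMatrix' (J s x : (Fin n → ℝ) →ₗ[ℝ] (Fin n → ℝ)))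
      (LinearMap.toMatrix' (A t x : (Fin n → ℝ) →ₗ[ℝ] (Fin n → ℝ))) t (by
        intro i j
        rw [← LinearMap.toMatrix'_comp]
        have h2 := hasDerivAt_pi.1 ((hJ' t x).clm_apply
          (hasDerivAt_const t (Pi.single j (1:ℝ) : Fin n → ℝ))) i
        simpa [LinearMap.toMatrix'_apply] using h2)
    simp only [LinearMap.det_toMatrix'] at h1
    refine h1.congr_deriv ?_
    congr 1
    rw [Matrix.trace]
    refine Finset.sum_congr rfl fun j _ => ?_
    rw [← hdiv, Matrix.diag_apply, LinearMap.toMatrix'_apply]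
    simp [A]
  have hρ' : ∀ t x, HasDerivAt (fun s => normSq (ψ (s, φ (s, x))))
      (2 * (starRingEnd ℂ (ψ (t, φ (t, x))) * (fderiv ℝ ψ (t, φ (t, x)) (1, 0)
        + ∑ j, ((hbar / m j * (P j (t, φ (t, x)) / ψ (t, φ (t, x))).im : ℝ) : ℂ)
          * P j (t, φ (t, x)))).re) t := by
    intro t x
    have h1 : HasDerivAt (fun s => ψ (s, φ (s, x)))
        (fderiv ℝ ψ (t, φ (t, x)) (1, w (t, x))) t :=
      HasFDerivAt.comp_hasDerivAt t (hψd (t, φ (t, x))).hasFDerivAt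
        ((hasDerivAt_id t).prodMk (hφw t x))
    have h2 : fderiv ℝ ψ (t, φ (t, x)) (1, w (t, x)) = fderiv ℝ ψ (t, φ (t, x)) (1, 0)
        + ∑ j, ((hbar / m j * (P j (t, φ (t, x)) / ψ (t, φ (t, x))).im : ℝ) : ℂ)
          * P j (t, φ (t, x)) := by
      have h3 : ((1 : ℝ), w (t, x)) = (1, 0) + ∑ j, w (t, x) j •
          ((0, Pi.single j 1) : ℝ × (Fin n → ℝ)) := by
        ext i
        · simp [Prod.fst_sum]
        · simp [Prod.snd_sum, Finset.sum_apply, Pi.single_apply]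
      rw [h3, map_add, map_sum]
      congr 1
      refine Finset.sum_congr rfl fun j _ => ?_
      rw [map_smul, Complex.real_smul]
    rw [h2] at h1
    have hr := Complex.reCLM.hasFDerivAt.comp_hasDerivAt t h1
    have hi := Complex.imCLM.hasFDerivAt.comp_hasDerivAt t h1
    have h4 := (hr.mul hr).add (hi.mul hi)
    refine (h4.congr_deriv ?_)
    simp only [Function.comp, Complex.reCLM_apply, Complex.imCLM_apply, Complex.mul_re,
      Complex.conj_re, Complex.conj_im]
    ring
  have hconst : ∀ t x, normSq (ψ (t, φ (t, x))) * (J t x).det = normSq (ψ (0, x)) := by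
    intro t x
    have hd : ∀ s, HasDerivAt (fun s => normSq (ψ (s, φ (s, x))) * (J s x).det) 0 s := by
      intro s
      refine ((hρ' s x).mul (hdet' s x)).congr_deriv ?_
      have := aux_alg hbar hhb m hm (V (φ (s, x))) (ψ (s, φ (s, x)))
        (fderiv ℝ ψ (s, φ (s, x)) (1, 0)) (hψ_ne _ _) (fun j => P j (s, φ (s, x)))
        (fun j => PP j (s, φ (s, x))) (hSch s (φ (s, x)))
      linear_combination (J s x).det * this
    have h1 := is_const_of_deriv_eq_zero (fun s => (hd s).differentiableAt)
      (fun s => (hd s).deriv) t 0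
    have h2 : J 0 x = ContinuousLinearMap.id ℝ _ := by
      have := hJφ 0 x
      simp only [hφ0] at this
      exact this.unique (hasFDerivAt_id x)
    rw [h2, hφ0] at h1
    have h3 : (ContinuousLinearMap.id ℝ (Fin n → ℝ)).det = 1 := LinearMap.det_id
    rw [h3, mul_one] at h1
    exact h1
  intro t
  obtain ⟨ι, hι, hl, hr⟩ := hφdiffeo t
  have hφc : Continuous (fun x => φ (t, x)) := hφ.continuous.comp (by fun_prop)
  ext s hs
  rw [Measure.map_apply hφc.measurable hs, withDensity_apply _ (hφc.measurable hs),
    withDensity_apply _ hs]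
  have himg : (fun x => φ (t, x)) '' ((fun x => φ (t, x)) ⁻¹' s) = s :=
    Set.image_preimage_eq s hr.surjective
  have hcv := lintegral_image_eq_lintegral_abs_det_fderiv_mul volume (hφc.measurable hs)
    (fun x _ => (hJφ t x).hasFDerivWithinAt) hl.injective.injOn
    (fun q => ENNReal.ofReal (Complex.normSq (ψ (t, q))))
  rw [himg] at hcv
  rw [hcv]
  refine lintegral_congr fun x => ?_
  have hpos : 0 < (J t x).det := by
    have h1 : 0 < normSq (ψ (0, x)) := Complex.normSq_pos.2 (hne _)
    rw [← hconst t x] at h1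
    exact (mul_pos_iff_of_pos_left (Complex.normSq_pos.2 (hne _))).1 h1
  rw [← hconst t x, abs_of_pos hpos, ← ENNReal.ofReal_mul hpos.le, mul_comm]
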